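/- Let G be a triangle-free simple graph on n vertices. Then hom_s(P_3, G) · q_n(G) ≤ hom_s(P_4, G), where q_n(G) is the smallest eigenvalue of the signless Laplacian matrix of G. -/

import Mathlib

/-- `homS H G` is the number of strong homomorphisms from `H` to `G`, i.e. maps
`φ : V(H) → V(G)` such that `uv ∈ E(H)` if and only if `φ(u)φ(v) ∈ E(G)`. -/
noncomputable def homS {W V : Type*} (H : SimpleGraph W) (G : SimpleGraph V) : ℕ :=
  Nat.card {φ : W → V // ∀ u v, H.Adj u v ↔ G.Adj (φ u) (φ v)}

theorem Matrix.IsHermitian.iInf_eigenvalues_mul_dotProduct_le {n : Type*} [Fintype n]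
    [DecidableEq n] {A : Matrix n n ℝ} (hA : A.IsHermitian) (x : n → ℝ) :
    (⨅ i, hA.eigenvalues i) * (x ⬝ᵥ x) ≤ x ⬝ᵥ A.mulVec x := by
  set b := hA.eigenvectorBasis
  set y : EuclideanSpace ℝ n := WithLp.toLp 2 x with hy
  have hnorm : x ⬝ᵥ x = ∑ i, inner ℝ y (b i) * inner ℝ (b i) y := by
    rw [b.sum_inner_mul_inner, EuclideanSpace.inner_eq_star_dotProduct]
    simp [hy]
  have hcoord (i : n) : inner ℝ (b i) (WithLp.toLp 2 (A.mulVec x)) =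
      hA.eigenvalues i * inner ℝ (b i) y := by
    have hmul : A.mulVec (b i).ofLp = hA.eigenvalues i • (b i).ofLp :=
      hA.mulVec_eigenvectorBasis i
    have hT : A.transpose = A := by simpa using hA.eq
    simp only [EuclideanSpace.inner_eq_star_dotProduct, hy, star_trivial]
    rw [dotProduct_comm, Matrix.dotProduct_mulVec, ← Matrix.mulVec_transpose, hT, hmul,
      smul_dotProduct, smul_eq_mul, dotProduct_comm]
  have hquad : x ⬝ᵥ A.mulVec x =
      ∑ i, inner ℝ y (b i) * inner ℝ (b i) (WithLp.toLp 2 (A.mulVec x)) := by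
    rw [b.sum_inner_mul_inner, EuclideanSpace.inner_eq_star_dotProduct]
    simp [hy, dotProduct_comm]
  rw [hnorm, hquad, Finset.mul_sum]
  refine Finset.sum_le_sum fun i _ => ?_
  rw [hcoord, real_inner_comm]
  have hle := ciInf_le (Set.finite_range hA.eigenvalues).bddBelow i
  nlinarith [mul_le_mul_of_nonneg_right hle (mul_self_nonneg (inner ℝ (b i) y))]

namespace SimpleGraph

variable {V : Type*} [DecidableEq V]

theorem CliqueFree.adjMatrix_mul_mul_eq_zero {G : SimpleGraph V} [DecidableRel G.Adj]
    (hG : G.CliqueFree 3) (a b c : V) :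
    G.adjMatrix ℝ a b * G.adjMatrix ℝ a c * G.adjMatrix ℝ b c = 0 := by
  have h : ¬(G.Adj a b ∧ G.Adj a c ∧ G.Adj b c) := fun h =>
    hG {a, b, c} (is3Clique_triple_iff.2 h)
  simp only [adjMatrix_apply]
  split_ifs <;> simp_all

variable [Fintype V]

theorem homS_pathGraph_three_eq_sum {G : SimpleGraph V} [DecidableRel G.Adj]
    (hG : G.CliqueFree 3) :
    (homS (pathGraph 3) G : ℝ) =
      ∑ u, ∑ v, ∑ w, G.adjMatrix ℝ u v * G.adjMatrix ℝ u w := by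
  classical
  let e : (V × V × V) ≃ (Fin 3 → V) :=
    { toFun := fun p => ![p.2.1, p.1, p.2.2]
      invFun := fun f => (f 1, f 0, f 2)
      left_inv := fun p => by simp
      right_inv := fun f => by ext i; fin_cases i <;> rfl }
  simp_rw [← Fintype.sum_prod_type']
  rw [homS, Nat.card_eq_fintype_card, Fintype.card_subtype, Finset.card_filter]
  push_cast
  rw [← e.sum_comp]
  refine Finset.sum_congr rfl fun ⟨u, v, w⟩ _ => ?_
  have htri : ¬(G.Adj u v ∧ G.Adj u w ∧ G.Adj v w) := fun h =>
    hG {u, v, w} (is3Clique_triple_iff.2 h)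
  simp only [adjMatrix_apply, ← ite_and, mul_ite, mul_one, mul_zero]
  congr 1
  simp only [e, Equiv.coe_fn_mk, Fin.forall_fin_succ, pathGraph_adj]
  simp [G.adj_comm v u, G.adj_comm w u, G.adj_comm w v]
  tauto

theorem homS_pathGraph_four_eq_sum {G : SimpleGraph V} [DecidableRel G.Adj]
    (hG : G.CliqueFree 3) :
    (homS (pathGraph 4) G : ℝ) =
      ∑ u, ∑ v, ∑ w, ∑ z, G.adjMatrix ℝ u v * G.adjMatrix ℝ w z *
        (G.adjMatrix ℝ u w * (1 - G.adjMatrix ℝ v z)) := by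
  classical
  let e : (V × V × V × V) ≃ (Fin 4 → V) :=
    { toFun := fun p => ![p.2.1, p.1, p.2.2.1, p.2.2.2]
      invFun := fun f => (f 1, f 0, f 2, f 3)
      left_inv := fun p => by simp
      right_inv := fun f => by ext i; fin_cases i <;> rfl }
  simp_rw [← Fintype.sum_prod_type']
  rw [homS, Nat.card_eq_fintype_card, Fintype.card_subtype, Finset.card_filter]
  push_cast
  rw [← e.sum_comp]
  refine Finset.sum_congr rfl fun ⟨u, v, w, z⟩ _ => ?_
  have huvw : ¬(G.Adj u v ∧ G.Adj u w ∧ G.Adj v w) := fun h =>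
    hG {u, v, w} (is3Clique_triple_iff.2 h)
  have huwz : ¬(G.Adj u w ∧ G.Adj u z ∧ G.Adj w z) := fun h =>
    hG {u, w, z} (is3Clique_triple_iff.2 h)
  have key : (∀ i j, (pathGraph 4).Adj i j ↔ G.Adj (e (u, v, w, z) i) (e (u, v, w, z) j)) ↔
      G.Adj u v ∧ G.Adj w z ∧ G.Adj u w ∧ ¬ G.Adj v z := by
    simp only [e, Equiv.coe_fn_mk, Fin.forall_fin_succ, pathGraph_adj]
    simp [G.adj_comm v u, G.adj_comm w u, G.adj_comm w v, G.adj_comm z u, G.adj_comm z v,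
      G.adj_comm z w]
    tauto
  simp only [key, adjMatrix_apply]
  split_ifs <;> simp_all

theorem dotProduct_signlessLaplacian_mulVec (G : SimpleGraph V) [DecidableRel G.Adj]
    (x : V → ℝ) :
    x ⬝ᵥ (G.degMatrix ℝ + G.adjMatrix ℝ).mulVec x =
      ∑ w, ∑ z, G.adjMatrix ℝ w z * (x w * x w + x w * x z) := by
  simp only [dotProduct, Matrix.add_mulVec, Pi.add_apply]
  refine Finset.sum_congr rfl fun w _ => ?_
  have hdeg : (G.degMatrix ℝ).mulVec x w = ∑ z, G.adjMatrix ℝ w z * x w := by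
    rw [degMatrix, Matrix.mulVec_diagonal, ← Finset.sum_mul]
    simp [adjMatrix_apply, ← card_neighborFinset_eq_degree, neighborFinset_eq_filter]
  rw [hdeg, Matrix.mulVec, dotProduct, ← Finset.sum_add_distrib, Finset.mul_sum]
  exact Finset.sum_congr rfl fun z _ => by ring

end SimpleGraph

/-- If `G` is a triangle-free graph, then `hom_s(P₃, G) * qₙ(G) ≤ hom_s(P₄, G)`, where
`qₙ(G)` is the smallest eigenvalue of the signless Laplacian matrix of `G` and `P_k` is
the path on `k` vertices. -/
theorem homS_path_mul_smallest_signless_laplacian_eigenvalue_le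
    {V : Type*} [Fintype V] [DecidableEq V] [Nonempty V]
    (G : SimpleGraph V) [DecidableRel G.Adj]
    (hG : G.CliqueFree 3)
    (hQ : (G.degMatrix ℝ + G.adjMatrix ℝ).IsHermitian) :
    (homS (SimpleGraph.pathGraph 3) G : ℝ) * (⨅ i, hQ.eigenvalues i) ≤
      (homS (SimpleGraph.pathGraph 4) G : ℝ) := by
  set q := ⨅ i, hQ.eigenvalues i
  let A := G.adjMatrix ℝ
  have hA : A = G.adjMatrix ℝ := rfl
  have hsymm (a b : V) : A a b = A b a := (G.isSymm_adjMatrix (α := ℝ)).apply b a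
  have hidem (a b : V) : A a b * A a b = A a b := by
    simp only [hA, SimpleGraph.adjMatrix_apply]; split_ifs <;> simp
  have hnonneg (a b : V) : 0 ≤ A a b := by
    simp only [hA, SimpleGraph.adjMatrix_apply]; split_ifs <;> simp
  have htri (a b c : V) : A a b * A a c * A b c = 0 := hG.adjMatrix_mul_mul_eq_zero a b c
  -- The test vector attached to the edge `uv` is the difference of the neighbourhood indicators.
  let x (u v w : V) : ℝ := A u w - A v w
  have hsq (u v w : V) : A u v * (x u v w * x u v w) = A u v * A u w + A u v * A v w := by
    simp only [x]
    linear_combination A u v * hidem u w + A u v * hidem v w - 2 * htri u v w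
  have hnorm : ∑ u, ∑ v, A u v * (x u v ⬝ᵥ x u v) =
      2 * (homS (SimpleGraph.pathGraph 3) G : ℝ) := by
    have hswap : ∑ u, ∑ v, ∑ w, A u v * A v w = ∑ u, ∑ v, ∑ w, A u v * A u w := by
      rw [Finset.sum_comm]
      simp_rw [hsymm]
    simp only [dotProduct, Finset.mul_sum, hsq, Finset.sum_add_distrib]
    rw [hswap, SimpleGraph.homS_pathGraph_three_eq_sum hG, two_mul]
  have hquad : ∑ u, ∑ v, A u v * (x u v ⬝ᵥ (G.degMatrix ℝ + A).mulVec (x u v)) =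
      2 * (homS (SimpleGraph.pathGraph 4) G : ℝ) := by
    have hterm (u v w z : V) :
        A u v * (A w z * (x u v w * x u v w + x u v w * x u v z)) =
          A u v * A w z * (A u w * (1 - A v z)) + A v u * A w z * (A v w * (1 - A u z)) := by
      rw [hsymm v u]
      simp only [x]
      linear_combination A w z * hsq u v w + A u v * htri u w z + A u v * htri v w z
    have hswap : ∑ u, ∑ v, ∑ w, ∑ z, A v u * A w z * (A v w * (1 - A u z)) =
        ∑ u, ∑ v, ∑ w, ∑ z, A u v * A w z * (A u w * (1 - A v z)) := Finset.sum_comm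
    simp only [hA, SimpleGraph.dotProduct_signlessLaplacian_mulVec]
    simp only [← hA, Finset.mul_sum, hterm, Finset.sum_add_distrib]
    rw [hswap, SimpleGraph.homS_pathGraph_four_eq_sum hG, two_mul]
  have hle : q * ∑ u, ∑ v, A u v * (x u v ⬝ᵥ x u v) ≤
      ∑ u, ∑ v, A u v * (x u v ⬝ᵥ (G.degMatrix ℝ + A).mulVec (x u v)) := by
    simp only [Finset.mul_sum]
    refine Finset.sum_le_sum fun u _ => Finset.sum_le_sum fun v _ => ?_
    rw [mul_left_comm]
    exact mul_le_mul_of_nonneg_left (hQ.iInf_eigenvalues_mul_dotProduct_le _) (hnonneg u v)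
  rw [hnorm, hquad] at hle
  linarith
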